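/- In the setting of the hyperelliptic residue data, assume additionally A12_n ≠ 0 for every n ∈ {1,…,N}, and define the 2×2 matrices A⁽ⁿ⁾ := [[−1/4 − β_n/2, A12_n], [−(β_n + β_n²)/(4·A12_n), 1/4 + β_n/2]]. Then Σ_{n=1}^N A⁽ⁿ⁾ = [[−1/4, 0], [0, 1/4]]; equivalently, the residue at u = ∞, A^(∞) := −Σ_{n=1}^N A⁽ⁿ⁾, equals the constant diagonal matrix diag(1/4, −1/4). -/

import Mathlib

open Finset

/-- The residue `A12^{(n)}` of the function `A₁₂(u)` associated with the differential `Ω`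
on the hyperelliptic curve `v² = ∏_{m=1}^N (u − u_m)`, as an explicit rational expression:
`A12_n = [Σ_j (1/(u_n−q_j) + α_j)·∏_{β≠j}(u_n−q_β)/(w_j·∏_{β≠j}(q_j−q_β))]
          · ∏_β (u_n−q_β) / ∏_{m≠n}(u_n−u_m)`. -/
noncomputable def A12res {g N : ℕ} (u : Fin N → ℂ) (q w a : Fin g → ℂ) (n : Fin N) : ℂ :=
  (∑ j, (1 / (u n - q j) + a j) * (∏ β ∈ univ.erase j, (u n - q β)) /
      (w j * ∏ β ∈ univ.erase j, (q j - q β))) *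
    (∏ β, (u n - q β)) / ∏ m ∈ univ.erase n, (u n - u m)

/-- The value `Ω_∞ = Ω(P_∞) = −2·Σ_j α_j/(w_j·∏_{β≠j}(q_j−q_β))`. -/
noncomputable def OmegaInfty {g : ℕ} (q w a : Fin g → ℂ) : ℂ :=
  -2 * ∑ j, a j / (w j * ∏ β ∈ univ.erase j, (q j - q β))

/-- The coefficient
`β_n = A12_n·(Σ_j 1/(w_j·(u_n−q_j)·∏_{β≠j}(q_j−q_β)) − Ω_∞/2)`. -/
noncomputable def betaCoef {g N : ℕ} (u : Fin N → ℂ) (q w a : Fin g → ℂ) (n : Fin N) : ℂ :=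
  A12res u q w a n *
    ((∑ j, 1 / (w j * (u n - q j) * ∏ β ∈ univ.erase j, (q j - q β))) -
      OmegaInfty q w a / 2)

/-- The residue matrix built from the coefficient `β` and the `(1,2)`-entry `a`. -/
noncomputable def resMat (β a : ℂ) : Matrix (Fin 2) (Fin 2) ℂ :=
  !![-(1 : ℂ) / 4 - β / 2, a; -(β + β ^ 2) / (4 * a), 1 / 4 + β / 2]

namespace Lagrange

open Polynomial

variable {F ι : Type*} [Field F] [DecidableEq ι] {s : Finset ι} {v : ι → F} {P : F[X]} {x : F}

/-- The residues of `P / nodal s v` sum to zero when `deg P + 2 ≤ deg (nodal s v)`. -/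
theorem sum_eval_div_prod_eq_zero (hvs : Set.InjOn v s) (hP : P.natDegree + 1 < #s) :
    ∑ i ∈ s, P.eval (v i) / ∏ j ∈ s.erase i, (v i - v j) = 0 := by
  rw [← coeff_eq_sum hvs (degree_le_natDegree.trans_lt (by exact_mod_cast (by lia)))]
  exact coeff_eq_zero_of_natDegree_lt (by lia)

/-- The residues of `P / ((X - x) * nodal s v)` sum to zero when `deg P < deg (nodal s v)`. -/
theorem sum_eval_div_sub_mul_prod (hvs : Set.InjOn v s) (hx : ∀ i ∈ s, x ≠ v i)
    (hP : P.degree < #s) :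
    ∑ i ∈ s, P.eval (v i) / ((v i - x) * ∏ j ∈ s.erase i, (v i - v j)) =
      -(P.eval x / (nodal s v).eval x) := by
  have h0 := eval_nodal_not_at_node hx
  have h : P.eval x = _ := congrArg (eval x) (eq_interpolate hvs hP)
  rw [eval_interpolate_not_at_node _ hx] at h
  rw [h, mul_div_cancel_left₀ _ h0, ← sum_neg_distrib]
  refine sum_congr rfl fun i _ => ?_
  rw [nodalWeight_eq_eval_nodal_erase_inv, eval_nodal, ← neg_sub x (v i), div_eq_mul_inv, mul_inv,
    inv_neg]
  ring

/-- The residues of `P / ((X - x) ^ 2 * nodal s v)` sum to zero when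
`deg P < deg (nodal s v)`. -/
theorem sum_eval_div_sub_sq_mul_prod (hvs : Set.InjOn v s) (hx : ∀ i ∈ s, x ≠ v i)
    (hP : P.degree < #s) :
    ∑ i ∈ s, P.eval (v i) / ((v i - x) ^ 2 * ∏ j ∈ s.erase i, (v i - v j)) =
      P.eval x * (derivative (nodal s v)).eval x / (nodal s v).eval x ^ 2 -
        (derivative P).eval x / (nodal s v).eval x := by
  have h0 := eval_nodal_not_at_node hx
  set p := (nodal s v).eval x with hp
  set K : F[X] := C p * P - C (P.eval x) * nodal s v with hK
  obtain ⟨M, hM⟩ : X - C x ∣ K := by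
    rw [dvd_iff_isRoot, IsRoot, hK]
    simp only [eval_sub, eval_mul, eval_C, ← hp]
    ring
  have hKdeg : K.degree ≤ #s := by
    refine (degree_sub_le _ _).trans (max_le ?_ ?_)
    · rw [← smul_eq_C_mul]
      exact (degree_smul_le _ _).trans hP.le
    · rw [← smul_eq_C_mul]
      exact (degree_smul_le _ _).trans degree_nodal.le
  have hMdeg : M.degree < #s := by
    rcases eq_or_ne M 0 with rfl | hM0
    · rw [degree_zero]
      exact WithBot.bot_lt_coe _
    · rw [hM, degree_mul, degree_X_sub_C, degree_eq_natDegree hM0] at hKdeg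
      rw [degree_eq_natDegree hM0]
      norm_cast at hKdeg ⊢
      lia
  have hMx : M.eval x = p * (derivative P).eval x - P.eval x * (derivative (nodal s v)).eval x := by
    have := congrArg (fun f => (derivative f).eval x) hM
    simp only [hK, derivative_sub, derivative_mul, derivative_C, derivative_X, eval_sub, eval_add,
      eval_mul, eval_C, eval_X, eval_zero, eval_one] at this
    linear_combination -this
  have key := sum_eval_div_sub_mul_prod hvs hx hMdeg
  rw [hMx, ← hp] at key
  have hterm : ∀ i ∈ s, P.eval (v i) / ((v i - x) ^ 2 * ∏ j ∈ s.erase i, (v i - v j)) =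
      p⁻¹ * (M.eval (v i) / ((v i - x) * ∏ j ∈ s.erase i, (v i - v j))) := by
    intro i hi
    have hxi : v i - x ≠ 0 := sub_ne_zero.2 (hx i hi).symm
    have := congrArg (eval (v i)) hM
    simp only [hK, eval_sub, eval_mul, eval_C, eval_X, eval_nodal_at_node hi] at this
    have hPi : P.eval (v i) = p⁻¹ * ((v i - x) * M.eval (v i)) := by
      rw [← this]
      field_simp
      ring
    rw [hPi, pow_two, mul_assoc (v i - x), mul_left_comm p⁻¹, mul_div_mul_left _ _ hxi,
      mul_div_assoc]
  rw [sum_congr rfl hterm, ← mul_sum, key]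
  field_simp
  ring

/-- The logarithmic derivative of the nodal polynomial. -/
theorem eval_derivative_nodal_div (hx : ∀ i ∈ s, x ≠ v i) :
    (derivative (nodal s v)).eval x / (nodal s v).eval x = ∑ i ∈ s, 1 / (x - v i) := by
  have h0 := eval_nodal_not_at_node hx
  rw [derivative_nodal, eval_finsetSum, sum_div]
  refine sum_congr rfl fun i hi => ?_
  have hxi : x - v i ≠ 0 := sub_ne_zero.2 (hx i hi)
  rw [nodal_eq_mul_nodal_erase hi, eval_mul] at h0 ⊢
  rw [eval_sub, eval_X, eval_C, div_mul_cancel_right₀ (right_ne_zero_of_mul h0), one_div]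

/-- The derivative of a polynomial of degree less than the number of nodes has vanishing
top divided difference. -/
theorem sum_eval_derivative_div_prod_eq_zero (hvs : Set.InjOn v s) (hP : P.degree < #s) :
    ∑ i ∈ s, (derivative P).eval (v i) / ∏ j ∈ s.erase i, (v i - v j) = 0 := by
  rcases s.eq_empty_or_nonempty with rfl | hs
  · simp
  have := hs.card_pos
  rw [← coeff_eq_sum hvs (degree_derivative_le.trans_lt hP), coeff_derivative,
    Nat.sub_add_cancel this, coeff_eq_zero_of_degree_lt hP, zero_mul]

end Lagrange

section ResidueSums

open Polynomial Lagrange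

variable {g N : ℕ} {u : Fin N → ℂ} {q w a : Fin g → ℂ}

/-- The coefficient of `1 / (x - q j)` in the partial fraction expansion of
`interpolant / ∏ β, (x - q β)`, the interpolant taking the value `1 / w j` at `q j`. -/
noncomputable def poleCoef (q w : Fin g → ℂ) (j : Fin g) : ℂ :=
  1 / (w j * ∏ β ∈ univ.erase j, (q j - q β))

/-- The partial fraction `∑ j, poleCoef j / (x - q j)`. -/
noncomputable def poleSum (q w : Fin g → ℂ) (x : ℂ) : ℂ :=
  ∑ j, poleCoef q w j / (x - q j)

/-- The polynomial of degree less than `g` taking the value `1 / w j` at `q j`. -/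
noncomputable def invInterpolant (q w : Fin g → ℂ) : ℂ[X] :=
  interpolate univ q fun j => 1 / w j

theorem A12res_eq_sum (n : Fin N) :
    A12res u q w a n = ∑ j, poleCoef q w j * (1 / (u n - q j) + a j) *
      ((nodal (univ.erase j) q).eval (u n) * (nodal univ q).eval (u n)) /
        ∏ m ∈ univ.erase n, (u n - u m) := by
  simp only [A12res, poleCoef, eval_nodal, sum_mul, sum_div]
  exact sum_congr rfl fun j _ => by ring

theorem betaCoef_eq (n : Fin N) :
    betaCoef u q w a n =
      A12res u q w a n * (poleSum q w (u n) + ∑ j, a j * poleCoef q w j) := by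
  have h1 : ∑ j, 1 / (w j * (u n - q j) * ∏ β ∈ univ.erase j, (q j - q β)) =
      poleSum q w (u n) := by
    refine sum_congr rfl fun j _ => ?_
    rw [poleCoef, div_div, mul_right_comm]
  have h2 : OmegaInfty q w a = -2 * ∑ j, a j * poleCoef q w j := by
    simp only [OmegaInfty, poleCoef, mul_one_div]
  rw [betaCoef, h1, h2]
  ring

theorem eval_nodal_mul_poleSum {x : ℂ} (hx : ∀ j, x ≠ q j) :
    (nodal univ q).eval x * poleSum q w x = (invInterpolant q w).eval x := by
  rw [invInterpolant, eval_interpolate_not_at_node _ fun j _ => hx j]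
  congr 1
  refine sum_congr rfl fun j _ => ?_
  rw [poleCoef, nodalWeight_eq_eval_nodal_erase_inv, eval_nodal, one_div, mul_inv]
  ring

theorem eval_nodal_eq_mul_erase (x : ℂ) (j : Fin g) :
    (nodal univ q).eval x = (x - q j) * (nodal (univ.erase j) q).eval x := by
  rw [nodal_eq_mul_nodal_erase (mem_univ j), eval_mul, eval_sub, eval_X, eval_C]

theorem degree_invInterpolant_lt (hq : Function.Injective q) :
    (invInterpolant q w).degree < #(univ : Finset (Fin g)) :=
  degree_interpolate_lt _ hq.injOn

theorem natDegree_invInterpolant_lt (hg : 1 ≤ g) (hq : Function.Injective q) :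
    (invInterpolant q w).natDegree < g := by
  have h := degree_invInterpolant_lt (w := w) hq
  rw [card_univ, Fintype.card_fin] at h
  rcases eq_or_ne (invInterpolant q w) 0 with h0 | h0
  · rw [h0, natDegree_zero]
    exact hg
  · exact (natDegree_lt_iff_degree_lt h0).2 h

theorem eval_invInterpolant (hq : Function.Injective q) (j : Fin g) :
    (invInterpolant q w).eval (q j) = 1 / w j :=
  eval_interpolate_at_node _ hq.injOn (mem_univ j)

theorem natDegree_nodal_erase (j : Fin g) : (nodal (univ.erase j) q).natDegree = g - 1 := by
  rw [natDegree_nodal, card_erase_of_mem (mem_univ j), card_univ, Fintype.card_fin]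

theorem sum_A12res (hg : 1 ≤ g) (hN : N = 2 * g + 1) (hu : Function.Injective u)
    (hqu : ∀ (j : Fin g) (n : Fin N), q j ≠ u n) :
    ∑ n, A12res u q w a n = 0 := by
  simp only [A12res_eq_sum]
  rw [sum_comm]
  refine sum_eq_zero fun j _ => ?_
  set R := nodal (univ.erase j) q with hR
  have hRdeg : R.natDegree = g - 1 := natDegree_nodal_erase j
  have hQdeg : (nodal univ q).natDegree = g := by simp
  have h1 : ∑ n, (R * R).eval (u n) / ∏ m ∈ univ.erase n, (u n - u m) = 0 := by
    refine sum_eval_div_prod_eq_zero hu.injOn ?_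
    have := natDegree_mul_le (p := R) (q := R)
    rw [card_univ, Fintype.card_fin]
    lia
  have h2 : ∑ n, (R * nodal univ q).eval (u n) / ∏ m ∈ univ.erase n, (u n - u m) = 0 := by
    refine sum_eval_div_prod_eq_zero hu.injOn ?_
    have := natDegree_mul_le (p := R) (q := nodal univ q)
    rw [card_univ, Fintype.card_fin]
    lia
  calc _ = ∑ n, (poleCoef q w j *
            ((R * R).eval (u n) / ∏ m ∈ univ.erase n, (u n - u m)) +
          poleCoef q w j * a j *
            ((R * nodal univ q).eval (u n) / ∏ m ∈ univ.erase n, (u n - u m))) := by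
        refine sum_congr rfl fun n _ => ?_
        have hx : u n - q j ≠ 0 := sub_ne_zero.2 (hqu j n).symm
        have hinv : 1 / (u n - q j) * (nodal univ q).eval (u n) = R.eval (u n) := by
          rw [eval_nodal_eq_mul_erase _ j, ← hR]
          field_simp
        rw [eval_mul, eval_mul]
        linear_combination (poleCoef q w j * R.eval (u n) /
          ∏ m ∈ univ.erase n, (u n - u m)) * hinv
    _ = 0 := by rw [sum_add_distrib, ← mul_sum, ← mul_sum, h1, h2]; ring

theorem poleCoef_mul_eval_nodal_erase (hq : Function.Injective q) (j : Fin g) :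
    poleCoef q w j * (nodal (univ.erase j) q).eval (q j) = 1 / w j := by
  have h : (nodal (univ.erase j) q).eval (q j) ≠ 0 :=
    eval_nodal_not_at_node fun i hi => hq.ne (ne_of_mem_erase hi).symm
  rw [poleCoef, ← eval_nodal, div_mul_eq_mul_div, one_mul, div_mul_cancel_right₀ h, one_div]

theorem one_div_sq_div_eval_nodal (hw : ∀ j, (w j) ^ 2 * ∏ m, (q j - u m) = 1) (j : Fin g) :
    (1 / w j) ^ 2 / (nodal univ u).eval (q j) = 1 := by
  rw [eval_nodal, div_pow, one_pow, div_div, hw j, div_one]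

theorem sum_A12res_mul_poleSum (hg : 1 ≤ g) (hN : N = 2 * g + 1) (hu : Function.Injective u)
    (hq : Function.Injective q) (hqu : ∀ (j : Fin g) (n : Fin N), q j ≠ u n)
    (hw : ∀ j, (w j) ^ 2 * ∏ m, (q j - u m) = 1) :
    ∑ n, A12res u q w a n * poleSum q w (u n) = -g := by
  simp only [A12res_eq_sum, sum_mul]
  rw [sum_comm]
  suffices h : ∀ j : Fin g, _ = (-1 : ℂ) by
    rw [sum_congr rfl fun j _ => h j]
    simp
  intro j
  set L := invInterpolant q w with hL
  set R := nodal (univ.erase j) q with hR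
  have hRdeg : R.natDegree = g - 1 := natDegree_nodal_erase j
  have hLdeg : L.natDegree < g := natDegree_invInterpolant_lt hg hq
  have hdeg := natDegree_mul_le (p := R) (q := L)
  have h1 := sum_eval_div_sub_mul_prod (s := univ) (P := R * L) hu.injOn (fun n _ => hqu j n)
    (degree_le_natDegree.trans_lt (by
      rw [card_univ, Fintype.card_fin]
      exact_mod_cast (by lia)))
  have h2 : ∑ n, (R * L).eval (u n) / ∏ m ∈ univ.erase n, (u n - u m) = 0 := by
    refine sum_eval_div_prod_eq_zero hu.injOn ?_
    rw [card_univ, Fintype.card_fin]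
    lia
  calc _ = ∑ n, (poleCoef q w j *
            ((R * L).eval (u n) / ((u n - q j) * ∏ m ∈ univ.erase n, (u n - u m))) +
          poleCoef q w j * a j *
            ((R * L).eval (u n) / ∏ m ∈ univ.erase n, (u n - u m))) := by
        refine sum_congr rfl fun n _ => ?_
        rw [eval_mul, hL, ← eval_nodal_mul_poleSum fun j => (hqu j n).symm]
        rw [div_eq_mul_inv _ ((u n - q j) * _), mul_inv]
        ring
    _ = -((poleCoef q w j * R.eval (q j)) * L.eval (q j) / (nodal univ u).eval (q j)) := by
        rw [sum_add_distrib, ← mul_sum, ← mul_sum, h1, h2, eval_mul]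
        ring
    _ = -1 := by
        rw [poleCoef_mul_eval_nodal_erase hq, eval_invInterpolant hq, ← pow_two,
          one_div_sq_div_eval_nodal hw]

theorem sum_A12res_mul_poleSum_sq (hg : 1 ≤ g) (hN : N = 2 * g + 1) (hu : Function.Injective u)
    (hq : Function.Injective q) (hqu : ∀ (j : Fin g) (n : Fin N), q j ≠ u n)
    (hw : ∀ j, (w j) ^ 2 * ∏ m, (q j - u m) = 1) :
    ∑ n, A12res u q w a n * poleSum q w (u n) ^ 2 =
      -∑ j, a j * poleCoef q w j - ∑ n, poleSum q w (u n) := by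
  set L := invInterpolant q w with hL
  have hLdeg : L.natDegree < g := natDegree_invInterpolant_lt hg hq
  have hdeg : (L ^ 2).degree < #(univ : Finset (Fin N)) := by
    refine degree_le_natDegree.trans_lt ?_
    rw [card_univ, Fintype.card_fin, natDegree_pow]
    exact_mod_cast (by lia)
  have hpole (j : Fin g) : ∑ n, poleCoef q w j * (1 / (u n - q j) + a j) *
      ((nodal (univ.erase j) q).eval (u n) * (nodal univ q).eval (u n)) /
        (∏ m ∈ univ.erase n, (u n - u m)) * poleSum q w (u n) ^ 2 =
      -(a j * poleCoef q w j) - ∑ n, poleCoef q w j / (u n - q j) -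
        2 * ((derivative L).eval (q j) / ∏ β ∈ univ.erase j, (q j - q β)) := by
    have h1 := sum_eval_div_sub_mul_prod hu.injOn (fun n _ => hqu j n) hdeg
    have h2 := sum_eval_div_sub_sq_mul_prod hu.injOn (fun n _ => hqu j n) hdeg
    have hP0 : (nodal univ u).eval (q j) ≠ 0 := eval_nodal_not_at_node fun n _ => hqu j n
    have hw0 : w j ≠ 0 := by
      intro h
      simpa [h] using hw j
    have hwP := one_div_sq_div_eval_nodal hw j
    have hlog := eval_derivative_nodal_div (s := univ) (v := u) fun n _ => hqu j n
    rw [eval_pow, eval_invInterpolant hq] at h1 h2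
    rw [hwP] at h1
    have h2' : (1 / w j) ^ 2 * (derivative (nodal univ u)).eval (q j) /
        (nodal univ u).eval (q j) ^ 2 - (derivative (L ^ 2)).eval (q j) /
          (nodal univ u).eval (q j) =
        ∑ n, 1 / (q j - u n) - 2 * w j * (derivative L).eval (q j) := by
      rw [← hlog]
      have hd : (derivative (L ^ 2)).eval (q j) = 2 * (1 / w j) * (derivative L).eval (q j) := by
        rw [derivative_sq, eval_mul, eval_mul, eval_C, eval_invInterpolant hq]
      have e1 : (nodal univ u).eval (q j) = (1 / w j) ^ 2 := by
        rwa [div_eq_one_iff_eq hP0, eq_comm] at hwP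
      rw [hd, e1]
      field_simp
    rw [h2'] at h2
    calc _ = ∑ n, (poleCoef q w j * ((L ^ 2).eval (u n) /
              ((u n - q j) ^ 2 * ∏ m ∈ univ.erase n, (u n - u m))) +
            a j * poleCoef q w j * ((L ^ 2).eval (u n) /
              ((u n - q j) * ∏ m ∈ univ.erase n, (u n - u m)))) := by
          refine sum_congr rfl fun n _ => ?_
          have hx : u n - q j ≠ 0 := sub_ne_zero.2 (hqu j n).symm
          rw [eval_pow, hL, ← eval_nodal_mul_poleSum fun j => (hqu j n).symm,
            eval_nodal_eq_mul_erase _ j]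
          field_simp
      _ = _ := by
          have h3 : ∑ n, poleCoef q w j / (u n - q j) =
              -(poleCoef q w j * ∑ n, 1 / (q j - u n)) := by
            rw [mul_sum, ← sum_neg_distrib]
            refine sum_congr rfl fun n _ => ?_
            rw [← neg_sub, div_neg, mul_one_div]
          have h4 : poleCoef q w j * w j = 1 / ∏ β ∈ univ.erase j, (q j - q β) := by
            rw [poleCoef, div_mul_eq_mul_div, one_mul, div_mul_cancel_left₀ hw0, one_div]
          rw [sum_add_distrib, ← mul_sum, ← mul_sum, h1, h2, h3]
          linear_combination (-2 * (derivative L).eval (q j)) * h4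
  have hL' : ∑ j, (derivative L).eval (q j) / ∏ β ∈ univ.erase j, (q j - q β) = 0 :=
    sum_eval_derivative_div_prod_eq_zero hq.injOn (degree_invInterpolant_lt hq)
  simp only [A12res_eq_sum, sum_mul]
  rw [sum_comm, sum_congr rfl fun j _ => hpole j, sum_sub_distrib, sum_sub_distrib, ← mul_sum, hL',
    sum_neg_distrib, sum_comm]
  simp [poleSum]

theorem sum_betaCoef (hg : 1 ≤ g) (hN : N = 2 * g + 1) (hu : Function.Injective u)
    (hq : Function.Injective q) (hqu : ∀ (j : Fin g) (n : Fin N), q j ≠ u n)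
    (hw : ∀ j, (w j) ^ 2 * ∏ m, (q j - u m) = 1) :
    ∑ n, betaCoef u q w a n = -g := by
  simp only [betaCoef_eq, mul_add, sum_add_distrib, ← sum_mul]
  rw [sum_A12res_mul_poleSum hg hN hu hq hqu hw, sum_A12res hg hN hu hqu, zero_mul, add_zero]

theorem sum_betaCoef_add_sq_div (hg : 1 ≤ g) (hN : N = 2 * g + 1) (hu : Function.Injective u)
    (hq : Function.Injective q) (hqu : ∀ (j : Fin g) (n : Fin N), q j ≠ u n)
    (hw : ∀ j, (w j) ^ 2 * ∏ m, (q j - u m) = 1) (hA : ∀ n, A12res u q w a n ≠ 0) :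
    ∑ n, -(betaCoef u q w a n + betaCoef u q w a n ^ 2) / (4 * A12res u q w a n) = 0 := by
  set c := ∑ j, a j * poleCoef q w j
  have hterm (n : Fin N) :
      -(betaCoef u q w a n + betaCoef u q w a n ^ 2) / (4 * A12res u q w a n) =
        -(1 / 4) * (poleSum q w (u n) + c + A12res u q w a n * poleSum q w (u n) ^ 2 +
          2 * c * (A12res u q w a n * poleSum q w (u n)) + c ^ 2 * A12res u q w a n) := by
    have := hA n
    rw [betaCoef_eq]
    field_simp
    ring
  simp only [hterm, ← mul_sum, sum_add_distrib]
  rw [sum_A12res_mul_poleSum_sq hg hN hu hq hqu hw, sum_A12res_mul_poleSum hg hN hu hq hqu hw,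
    sum_A12res hg hN hu hqu, sum_const, card_univ, Fintype.card_fin, nsmul_eq_mul]
  have hNc : (N : ℂ) = 2 * g + 1 := by exact_mod_cast hN
  rw [hNc]
  ring

end ResidueSums

/-- In the setting of the hyperelliptic residue data,
`Σ_n A⁽ⁿ⁾ = [[−1/4, 0], [0, 1/4]]`; equivalently, the residue at `u = ∞`,
`A^(∞) = −Σ_n A⁽ⁿ⁾`, equals the constant diagonal matrix `diag(1/4, −1/4)`. -/
theorem sum_residue_matrices {g N : ℕ} (hg : 1 ≤ g) (hN : N = 2 * g + 1)
    (u : Fin N → ℂ) (q w a : Fin g → ℂ)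
    (hu : ∀ m n : Fin N, m ≠ n → u m ≠ u n)
    (hq : ∀ i j : Fin g, i ≠ j → q i ≠ q j)
    (hqu : ∀ (j : Fin g) (n : Fin N), q j ≠ u n)
    (hw : ∀ j, (w j) ^ 2 * ∏ m, (q j - u m) = 1)
    (hA : ∀ n, A12res u q w a n ≠ 0) :
    (∑ n, resMat (betaCoef u q w a n) (A12res u q w a n) =
        !![-(1 : ℂ) / 4, 0; 0, 1 / 4]) ∧
      (-(∑ n, resMat (betaCoef u q w a n) (A12res u q w a n)) =
        !![(1 : ℂ) / 4, 0; 0, -(1 / 4)]) := by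
  have hu' : Function.Injective u := fun m n h => by_contra fun hmn => hu m n hmn h
  have hq' : Function.Injective q := fun i j h => by_contra fun hij => hq i j hij h
  have hβ := sum_betaCoef (a := a) hg hN hu' hq' hqu hw
  have hsum : ∑ n, resMat (betaCoef u q w a n) (A12res u q w a n) =
      !![-(1 : ℂ) / 4, 0; 0, 1 / 4] := by
    have hNc : (N : ℂ) = 2 * g + 1 := by exact_mod_cast hN
    ext i j
    rw [Matrix.sum_apply]
    fin_cases i <;> fin_cases j <;> simp only [resMat, Fin.zero_eta, Fin.mk_one, Matrix.of_apply,
      Matrix.cons_val', Matrix.cons_val_zero, Matrix.cons_val_one, Matrix.cons_val_fin_one]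
    · rw [sum_sub_distrib, ← sum_div univ (betaCoef u q w a), hβ, sum_const, card_univ,
        Fintype.card_fin, nsmul_eq_mul, hNc]
      ring
    · exact sum_A12res hg hN hu' hqu
    · exact sum_betaCoef_add_sq_div hg hN hu' hq' hqu hw hA
    · rw [sum_add_distrib, ← sum_div univ (betaCoef u q w a), hβ, sum_const, card_univ,
        Fintype.card_fin, nsmul_eq_mul, hNc]
      ring
  refine ⟨hsum, ?_⟩
  rw [hsum]
  ext i j
  fin_cases i <;> fin_cases j <;> simp [neg_div]
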